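/- arXiv:2412.10733 — 7 statements merged into one kernel-verified Lean document; each statement's English description precedes it below -/
import Mathlib

section
/- Universal Pattern Formation is unsolvable under the fully synchronous scheduler even if the robots have strong multiplicity detection, share the same coordinate system, move rigidly, and one of them is a distinguishable leader. Concretely: let n ≥ 3, let f, g : ℝ² → Multiset ℝ² → ℝ² be any algorithms (g for the leader, robot 0; f for all other robots), let a, b ∈ ℝ² with a ≠ b, let c₀ : Fin n → ℝ² be the configuration with c₀ 0 = a and c₀ i = b for all i ≠ 0, and define c_{t+1} to be the fully synchronous rigid leader step of (g, f) applied to c_t. Then for every t, |Q(c_t)| ≤ 2; in particular, for every finite set of distinct points P̂ ⊆ ℝ² with |P̂| ≥ 3, at no time t does Q(c_t) have cardinality |P̂|, so the robots never form the pattern P̂. -/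
noncomputable section

open scoped Classical

abbrev Plane := EuclideanSpace ℝ (Fin 2)

/-- `UPF` is unsolvable under `FSYNC` even with strong multiplicity detection, a common
coordinate system, rigid movements and a distinguishable leader: starting from the
configuration where the leader (robot `0`) is at `a` and all `n - 1 ≥ 2` other robots are
at `b ≠ a`, every fully synchronous rigid leader execution of any pair of algorithms
`(g, f)` occupies at most `2` distinct points at every time; in particular no pattern of
`≥ 3` points is ever formed. -/
theorem stmt_3 (n : ℕ) (hn : 3 ≤ n)
    (f g : Plane → Multiset Plane → Plane)
    (a b : Plane) (hab : a ≠ b)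
    (c : ℕ → Fin n → Plane)
    (h0 : c 0 ⟨0, by omega⟩ = a)
    (h0' : ∀ i : Fin n, i ≠ ⟨0, by omega⟩ → c 0 i = b)
    (hleader : ∀ t, c (t + 1) ⟨0, by omega⟩ =
      g (c t ⟨0, by omega⟩) (Multiset.map (c t) Finset.univ.val))
    (hstep : ∀ t, ∀ i : Fin n, i ≠ ⟨0, by omega⟩ →
      c (t + 1) i = f (c t i) (Multiset.map (c t) Finset.univ.val)) :
    (∀ t, (Finset.image (c t) Finset.univ).card ≤ 2) ∧
    (∀ P : Finset Plane, 3 ≤ P.card →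
      ∀ t, (Finset.image (c t) Finset.univ).card ≠ P.card) := by
  have hfollow : ∀ t, ∃ p, ∀ i : Fin n, i ≠ ⟨0, by omega⟩ → c t i = p := by
    intro t
    induction t with
    | zero => exact ⟨b, h0'⟩
    | succ t ih =>
      obtain ⟨p, hp⟩ := ih
      exact ⟨_, fun i hi => by rw [hstep t i hi, hp i hi]⟩
  have hcard : ∀ t, (Finset.image (c t) Finset.univ).card ≤ 2 := by
    intro t
    obtain ⟨p, hp⟩ := hfollow t
    refine (Finset.card_le_card (t := {c t ⟨0, by omega⟩, p}) ?_).trans Finset.card_le_two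
    intro x hx
    obtain ⟨i, -, rfl⟩ := Finset.mem_image.mp hx
    by_cases hi : i = ⟨0, by omega⟩
    · simp [hi]
    · simp [hp i hi]
  exact ⟨hcard, fun P hP t => ((hcard t).trans_lt hP).ne⟩
end
end

section
/- Gathering is unsolvable under sequential schedulers for oblivious disoriented robots without multiplicity detection: for every algorithm A : Finset ℝ² → ℝ² (input: the set of occupied points expressed in the active robot's local frame; output: a destination in that frame) and every n ≥ 3, there exist an initial configuration c₀ : Fin n → ℝ², a fair sequential activation schedule σ : ℕ → Fin n, and for each round t a local coordinate frame φ_t at the position c_t (σ t) of the active robot, such that in the resulting rigid execution — where c_{t+1} (σ t) = φ_t⁻¹ (A (image of Q(c_t) under φ_t)) and c_{t+1} j = c_t j for all j ≠ σ t — for every t the robots do not all occupy a single point, i.e., |Q(c_t)| ≥ 2. -/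
noncomputable section

open scoped Classical

/-- A robot `i` activated in configuration `c` may, in a suitable local frame, move so that the
configuration becomes `c'`. -/
def IsMove (A : Finset Plane → Plane) {n : ℕ} (c : Fin n → Plane) (i : Fin n)
    (c' : Fin n → Plane) : Prop :=
  ∃ (k : ℝ) (L : Plane ≃ₗᵢ[ℝ] Plane), 0 < k ∧
    c' i = L.symm (k⁻¹ • A (Finset.image (fun x => k • L (x - c i))
      (Finset.image c Finset.univ))) + c i ∧
    ∀ j, j ≠ i → c' j = c j

/-- A linear similarity maps any nonzero vector to any other one. -/
theorem exists_smul_linearIsometryEquiv_eq {u v : Plane} (hu : u ≠ 0) (hv : v ≠ 0) :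
    ∃ (k : ℝ) (L : Plane ≃ₗᵢ[ℝ] Plane), 0 < k ∧ k • L u = v := by
  have hu' : 0 < ‖u‖ := norm_pos_iff.2 hu
  have hv' : 0 < ‖v‖ := norm_pos_iff.2 hv
  have hk : 0 < ‖v‖ / ‖u‖ := div_pos hv' hu'
  have hnorm : ‖(‖v‖ / ‖u‖) • u‖ = ‖v‖ := by
    rw [norm_smul, Real.norm_of_nonneg hk.le, div_mul_cancel₀ _ hu'.ne']
  refine ⟨‖v‖ / ‖u‖, (ℝ ∙ ((‖v‖ / ‖u‖) • u - v))ᗮ.reflection, hk, ?_⟩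
  rw [← map_smul]
  exact Submodule.reflection_sub hnorm

theorem two_le_card_image {ι : Type*} [Fintype ι] {c : ι → Plane} {a b : ι} (h : c a ≠ c b) :
    2 ≤ (Finset.image c Finset.univ).card :=
  Finset.one_lt_card.2 ⟨c a, by simp, c b, by simp, h⟩

theorem exists_image_eq_pair {n : ℕ} {c : Fin n → Plane}
    (h : (Finset.image c Finset.univ).card = 2) (i : Fin n) :
    ∃ q, q ≠ c i ∧ Finset.image c Finset.univ = {c i, q} := by
  obtain ⟨p, q, hpq, hQ⟩ := Finset.card_eq_two.1 h
  have hi : c i ∈ Finset.image c Finset.univ := by simp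
  rw [hQ, Finset.mem_insert, Finset.mem_singleton] at hi
  rcases hi with hi | hi
  · exact ⟨q, by rw [hi]; exact hpq.symm, by rw [hQ, hi]⟩
  · exact ⟨p, by rw [hi]; exact hpq, by rw [hQ, hi, Finset.pair_comm]⟩

theorem exists_isMove_of_ne {A : Finset Plane → Plane} {v : Plane} (hv : v ≠ 0)
    (hA : A {0, v} ≠ v) {n : ℕ} {c : Fin n → Plane}
    (hc : 2 ≤ (Finset.image c Finset.univ).card) (i : Fin n) :
    ∃ c', IsMove A c i c' ∧ 2 ≤ (Finset.image c' Finset.univ).card := by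
  rcases hc.eq_or_lt with h2 | h3
  · obtain ⟨q, hq, hQ⟩ := exists_image_eq_pair h2.symm i
    obtain ⟨k, L, hk, hL⟩ := exists_smul_linearIsometryEquiv_eq (sub_ne_zero.2 hq) hv
    have hview : Finset.image (fun x => k • L (x - c i)) (Finset.image c Finset.univ)
        = {0, v} := by
      rw [hQ, Finset.image_insert, Finset.image_singleton, hL]
      simp
    obtain ⟨j, -, hj⟩ := Finset.mem_image.1 (show q ∈ Finset.image c Finset.univ by simp [hQ])
    have hji : j ≠ i := by
      rintro rfl
      exact hq hj.symm
    refine ⟨Function.update c i (L.symm (k⁻¹ • A {0, v}) + c i),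
      ⟨k, L, hk, by rw [hview, Function.update_self], fun l hl => Function.update_of_ne hl _ _⟩,
      two_le_card_image (a := i) (b := j) ?_⟩
    rw [Function.update_self, Function.update_of_ne hji, hj]
    intro h
    apply hA
    have hv' := hL
    rwa [← eq_sub_of_add_eq h, L.apply_symm_apply, smul_inv_smul₀ hk.ne'] at hv'
  · have he : 1 < ((Finset.image c Finset.univ).erase (c i)).card := by
      have := Finset.pred_card_le_card_erase (s := Finset.image c Finset.univ) (a := c i)
      omega
    obtain ⟨x, hx, y, hy, hxy⟩ := Finset.one_lt_card.1 he
    obtain ⟨hxi, hx⟩ := Finset.mem_erase.1 hx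
    obtain ⟨hyi, hy⟩ := Finset.mem_erase.1 hy
    obtain ⟨a, -, rfl⟩ := Finset.mem_image.1 hx
    obtain ⟨b, -, rfl⟩ := Finset.mem_image.1 hy
    refine ⟨Function.update c i _,
      ⟨1, LinearIsometryEquiv.refl ℝ Plane, one_pos, Function.update_self _ _ _,
        fun l hl => Function.update_of_ne hl _ _⟩,
      two_le_card_image (a := a) (b := b) ?_⟩
    rwa [Function.update_of_ne (fun h => hxi (congrArg c h)),
      Function.update_of_ne (fun h => hyi (congrArg c h))]

/-- If the algorithm always swaps between two occupied points, then a robot that shares its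
position can be activated without changing the set of occupied points. -/
theorem exists_isMove_of_eq {A : Finset Plane → Plane} (hA : ∀ v ≠ 0, A {0, v} = v)
    {n : ℕ} {c : Fin n → Plane} {i j : Fin n} {q : Plane} (hq : q ≠ c i)
    (hQ : Finset.image c Finset.univ = {c i, q}) (hji : j ≠ i) (hj : c j = c i) :
    IsMove A c i (Function.update c i q) ∧
      Finset.image (Function.update c i q) Finset.univ = {c i, q} := by
  refine ⟨⟨1, LinearIsometryEquiv.refl ℝ Plane, one_pos, ?_,
    fun l hl => Function.update_of_ne hl _ _⟩, ?_⟩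
  · rw [hQ, Finset.image_insert, Finset.image_singleton]
    simp [hA _ (sub_ne_zero.2 hq), LinearIsometryEquiv.symm]
  · ext x
    simp only [Finset.mem_image, Finset.mem_univ, true_and, Finset.mem_insert,
      Finset.mem_singleton]
    constructor
    · rintro ⟨l, rfl⟩
      by_cases hl : l = i
      · subst hl
        simp
      · rw [Function.update_of_ne hl]
        have : c l ∈ Finset.image c Finset.univ := by simp
        simpa [hQ] using this
    · rintro (rfl | rfl)
      · exact ⟨j, by rw [Function.update_of_ne hji, hj]⟩
      · exact ⟨i, Function.update_self _ _ _⟩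

/-- From any configuration satisfying a suitable invariant, any prescribed robot can be activated
second, without ever gathering. -/
theorem exists_invariant (A : Finset Plane → Plane) {n : ℕ} (hn : 3 ≤ n) :
    ∃ (P : (Fin n → Plane) → Prop) (R : Fin n → (Fin n → Plane) → Prop),
      (∃ c, P c) ∧ (∀ c, P c → 2 ≤ (Finset.image c Finset.univ).card) ∧
      (∀ i c, P c → ∃ j c', IsMove A c j c' ∧ P c' ∧ R i c') ∧
      (∀ i c, P c → R i c → ∃ c', IsMove A c i c' ∧ P c') := by
  have hcard : ∃ c : Fin n → Plane, (Finset.image c Finset.univ).card = 2 := by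
    obtain ⟨e, he⟩ := exists_ne (0 : Plane)
    refine ⟨fun i => if i = ⟨0, by omega⟩ then 0 else e,
      Finset.card_eq_two.2 ⟨0, e, he.symm, ?_⟩⟩
    ext x
    simp only [Finset.mem_image, Finset.mem_univ, true_and, Finset.mem_insert,
      Finset.mem_singleton]
    constructor
    · rintro ⟨l, rfl⟩
      split_ifs <;> simp
    · rintro (rfl | rfl)
      · exact ⟨⟨0, by omega⟩, by simp⟩
      · exact ⟨⟨1, by omega⟩, by simp⟩
  by_cases hA : ∀ v ≠ 0, A {0, v} = v
  · refine ⟨fun c => (Finset.image c Finset.univ).card = 2, fun i c => ∃ j, j ≠ i ∧ c j = c i,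
      hcard, fun c hc => hc.ge, fun i c hc => ?_, fun i c hc => ?_⟩
    · obtain ⟨q, hq, hQ⟩ := exists_image_eq_pair hc i
      by_cases hs : ∃ j, j ≠ i ∧ c j = c i
      · obtain ⟨j, hji, hj⟩ := hs
        obtain ⟨hm, hQ'⟩ := exists_isMove_of_eq hA hq hQ hji hj
        obtain ⟨l, -, hl⟩ :=
          Finset.mem_image.1 (show q ∈ Finset.image c Finset.univ by simp [hQ])
        have hli : l ≠ i := by
          rintro rfl
          exact hq hl.symm
        exact ⟨i, _, hm, by simpa only [hQ', ← hQ] using hc,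
          l, hli, by rw [Function.update_of_ne hli, Function.update_self, hl]⟩
      · push Not at hs
        have hq' : ∀ l, l ≠ i → c l = q := fun l hl => by
          have : c l ∈ Finset.image c Finset.univ := by simp
          rw [hQ, Finset.mem_insert, Finset.mem_singleton] at this
          exact this.resolve_left (hs l hl)
        obtain ⟨j, hj⟩ : ∃ j, j ∉ ({i} : Finset (Fin n)) := by
          by_contra! h
          have := Finset.card_le_card (fun x _ => h x : Finset.univ ⊆ _)
          simp at this
          omega
        obtain ⟨l, hl⟩ : ∃ l, l ∉ ({i, j} : Finset (Fin n)) := by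
          by_contra! h
          have := (Finset.card_le_card (fun x _ => h x : Finset.univ ⊆ _)).trans
            Finset.card_le_two
          simp at this
          omega
        simp only [Finset.mem_singleton, Finset.mem_insert, not_or] at hj hl
        have hcj := hq' j hj
        obtain ⟨hm, hQ'⟩ := exists_isMove_of_eq hA (q := c i) (hcj ▸ hq.symm)
          (by rw [hQ, hcj, Finset.pair_comm]) hl.2 ((hq' l hl.1).trans hcj.symm)
        exact ⟨j, _, hm, by simpa only [hQ', hcj, Finset.pair_comm q, ← hQ] using hc,
          j, hj, by rw [Function.update_self, Function.update_of_ne (Ne.symm hj)]⟩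
    · rintro ⟨j, hji, hj⟩
      obtain ⟨q, hq, hQ⟩ := exists_image_eq_pair hc i
      obtain ⟨hm, hQ'⟩ := exists_isMove_of_eq hA hq hQ hji hj
      exact ⟨_, hm, by simpa only [hQ', ← hQ] using hc⟩
  · push Not at hA
    obtain ⟨v, hv, hAv⟩ := hA
    refine ⟨fun c => 2 ≤ (Finset.image c Finset.univ).card, fun _ _ => True,
      hcard.imp fun c hc => hc.ge, fun c hc => hc, fun i c hc => ?_, fun i c hc _ => ?_⟩
    · obtain ⟨c', hm, hc'⟩ := exists_isMove_of_ne hv hAv hc i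
      exact ⟨i, c', hm, hc', trivial⟩
    · exact exists_isMove_of_ne hv hAv hc i

/-- `Gathering` is unsolvable under sequential schedulers for oblivious disoriented robots
without multiplicity detection: for any algorithm `A` (acting on the set of occupied
points seen in the active robot's local frame) and any `n ≥ 3` there are an initial
configuration, a fair sequential schedule `σ`, and local frames
`x ↦ k t • L t (x - c t (σ t))` (with `k t > 0` and `L t` a linear isometry) such that the
resulting rigid execution never occupies a single point. -/
theorem stmt_4 (A : Finset Plane → Plane) (n : ℕ) (hn : 3 ≤ n) :
    ∃ (c : ℕ → Fin n → Plane) (σ : ℕ → Fin n) (k : ℕ → ℝ)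
      (L : ℕ → Plane ≃ₗᵢ[ℝ] Plane),
      (∀ i : Fin n, ∀ t : ℕ, ∃ t' > t, σ t' = i) ∧
      (∀ t, 0 < k t) ∧
      (∀ t, c (t + 1) (σ t) =
        (L t).symm ((k t)⁻¹ • A (Finset.image
          (fun x => k t • L t (x - c t (σ t)))
          (Finset.image (c t) Finset.univ))) + c t (σ t)) ∧
      (∀ t, ∀ j : Fin n, j ≠ σ t → c (t + 1) j = c t j) ∧
      (∀ t, 2 ≤ (Finset.image (c t) Finset.univ).card) := by
  obtain ⟨P, R, ⟨c₀, h₀⟩, hP, hfst, hsnd⟩ := exists_invariant A hn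
  let target : ℕ → Fin n := fun t => ⟨t / 2 % n, Nat.mod_lt _ (by omega)⟩
  let State (t : ℕ) := {c : Fin n → Plane // P c ∧ (t % 2 = 1 → R (target t) c)}
  have hstep : ∀ (t : ℕ) (s : State t), ∃ (j : Fin n) (s' : State (t + 1)),
      IsMove A s.1 j s'.1 ∧ (t % 2 = 1 → j = target t) := by
    rintro t ⟨c, hc, hR⟩
    rcases Nat.mod_two_eq_zero_or_one t with ht | ht
    · obtain ⟨j, c', hm, hc', hR'⟩ := hfst (target (t + 1)) c hc
      exact ⟨j, ⟨c', hc', fun _ => hR'⟩, hm, fun h => by omega⟩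
    · obtain ⟨c', hm, hc'⟩ := hsnd (target t) c hc (hR ht)
      exact ⟨target t, ⟨c', hc', fun h => by omega⟩, hm, fun _ => rfl⟩
  choose who next hmove hwho using hstep
  let run : ∀ t, State t := fun t =>
    Nat.rec (motive := State) ⟨c₀, h₀, fun h => by simp at h⟩ next t
  have hrun : ∀ t, IsMove A (run t).1 (who t (run t)) (run (t + 1)).1 := fun t =>
    hmove t (run t)
  choose k L hk hc hfix using hrun
  refine ⟨fun t => (run t).1, fun t => who t (run t), k, L, fun i t => ?_, hk, hc, hfix,
    fun t => hP _ (run t).2.1⟩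
  have hle : t ≤ t * n := Nat.le_mul_of_pos_right t (by omega)
  refine ⟨2 * (t * n + i) + 1, by omega, ?_⟩
  refine (hwho _ _ (by omega)).trans (Fin.ext ?_)
  change (2 * (t * n + i) + 1) / 2 % n = i
  rw [show (2 * (t * n + i) + 1) / 2 = i + t * n by omega, Nat.add_mul_mod_self_right,
    Nat.mod_eq_of_lt i.2]
end
end

section
/- Two robots running the algorithm 'move to the other robot's current position' gather under any sequential scheduler even with non-rigid movements: let δ > 0 and let x, y : ℕ → ℝ² be sequences such that for every t either x(t+1) is a δ-non-rigid move from x t toward y t and y(t+1) = y t, or y(t+1) is a δ-non-rigid move from y t toward x t and x(t+1) = x t. Then there exists t ≤ ⌈dist(x 0, y 0) / δ⌉ such that x t' = y t' for all t' ≥ t, i.e., Rendezvous is achieved and maintained forever. -/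
noncomputable section

/-- For `δ > 0`, a `δ`-non-rigid move from `p` toward `d` is a point `p'` of the closed
segment `[p, d]` with `dist p' d ≤ max (dist p d - δ) 0`. -/
def NonRigidMove (δ : ℝ) (p d p' : Plane) : Prop :=
  p' ∈ segment ℝ p d ∧ dist p' d ≤ max (dist p d - δ) 0

/-- A pair of points whose distance drops by at least `δ` (or to zero) in every round is, after
`t` rounds, closer by at least `t * δ` (or at distance zero). -/
theorem dist_le_max_sub_mul {α : Type*} [PseudoMetricSpace α] {δ : ℝ} (hδ : 0 ≤ δ) {x y : ℕ → α}
    (h : ∀ t, dist (x (t + 1)) (y (t + 1)) ≤ max (dist (x t) (y t) - δ) 0) (t : ℕ) :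
    dist (x t) (y t) ≤ max (dist (x 0) (y 0) - t * δ) 0 := by
  induction t with
  | zero => simp
  | succ t ih =>
    refine (h t).trans (max_le ?_ (le_max_right _ _))
    push_cast
    rcases le_max_iff.1 ih with h' | h'
    · exact le_max_of_le_left (by linarith)
    · exact le_max_of_le_right (by linarith)

/-- Two robots, each moving (when activated by a sequential scheduler) toward the other's
current position with `δ`-non-rigid movements, meet within `⌈dist (x 0) (y 0) / δ⌉` rounds
and stay together forever. -/
theorem stmt_5 (δ : ℝ) (hδ : 0 < δ) (x y : ℕ → Plane)
    (hstep : ∀ t,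
      (NonRigidMove δ (x t) (y t) (x (t + 1)) ∧ y (t + 1) = y t) ∨
      (NonRigidMove δ (y t) (x t) (y (t + 1)) ∧ x (t + 1) = x t)) :
    ∃ t ≤ ⌈dist (x 0) (y 0) / δ⌉₊, ∀ t' ≥ t, x t' = y t' := by
  have hdist : ∀ t, dist (x (t + 1)) (y (t + 1)) ≤ max (dist (x t) (y t) - δ) 0 := by
    intro t
    rcases hstep t with ⟨⟨-, h⟩, hy⟩ | ⟨⟨-, h⟩, hx⟩
    · rwa [hy]
    · rwa [hx, dist_comm (x t), dist_comm (x t)]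
  refine ⟨_, le_rfl, fun t ht => dist_le_zero.1 ?_⟩
  have hle : dist (x 0) (y 0) ≤ t * δ := (div_le_iff₀ hδ).1 (Nat.ceil_le.1 ht)
  exact (dist_le_max_sub_mul hδ.le hdist t).trans (max_le (by linarith) le_rfl)
end
end

section
/- Gathering is solvable with weak multiplicity detection under any sequential scheduler: there exists an algorithm A : Finset (ℝ² × Bool) → ℝ² (input: the set of occupied points expressed in the active robot's local frame, each tagged with a Boolean that is true iff at least two robots occupy that point; output: a destination in that frame) such that for every n ≥ 1, every δ > 0, every initial configuration c₀ : Fin n → ℝ², every fair sequential activation schedule σ : ℕ → Fin n, every choice of local coordinate frames φ_t at the active robot's position c_t (σ t), and every execution in which at each round t robot σ t moves to a δ-non-rigid move from its current position toward φ_t⁻¹ (A (S_t)) — where S_t = { (φ_t q, m_q) : q ∈ Q(c_t) } and m_q is true iff at least two robots occupy q in c_t — while all other robots stay put, there exists a time T such that for all t ≥ T all n robots occupy one and the same point. -/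
noncomputable section

open scoped Classical

/-- The points occupied by at least two robots. -/
def multiplicityPoints {n : ℕ} (c : Fin n → Plane) : Set Plane :=
  {x | ∃ i j, i ≠ j ∧ c i = x ∧ c j = x}

/-- `q` is an occupied point other than `p` such that `p, q` realise the least distance
between distinct occupied points. -/
def IsClosestPartner (O : Set Plane) (p q : Plane) : Prop :=
  q ∈ O ∧ q ≠ p ∧ ∀ a ∈ O, ∀ b ∈ O, a ≠ b → dist p q ≤ dist a b

/-- The destinations `d` allowed to a robot at `p` when the occupied points are `O` and the
multiplicity points are `M`. With a unique multiplicity point, the robots closest to it join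
it; with several, robots leave the multiplicity points towards free space; with none, the
robots of a closest pair approach each other. -/
structure IsDestination (O M : Set Plane) (p d : Plane) : Prop where
  unique : ∀ m, M = {m} →
    ((∀ q ∈ O, q ≠ m → dist p m ≤ dist q m) ∧ d = m) ∨
      (¬ (∀ q ∈ O, q ≠ m → dist p m ≤ dist q m) ∧ d = p)
  several : M.Nontrivial →
    (p ∈ M ∧ d ≠ p ∧ ∀ q ∈ O, q ≠ p → dist p d < dist p q) ∨ (p ∉ M ∧ d = p)
  none : M = ∅ → IsClosestPartner O p d ∨ ((¬ ∃ q, IsClosestPartner O p q) ∧ d = p)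

theorem exists_near_of_finite {O : Set Plane} (hO : O.Finite) (p : Plane) :
    ∃ d, d ≠ p ∧ ∀ q ∈ O, q ≠ p → dist p d < dist p q := by
  obtain ⟨r, hr, hr'⟩ : ∃ r > 0, ∀ q ∈ O, q ≠ p → r < dist p q := by
    induction O, hO using Set.Finite.induction_on with
    | empty => exact ⟨1, one_pos, by simp⟩
    | @insert a O _ _ ih =>
      obtain ⟨r, hr, h⟩ := ih
      by_cases hap : a = p
      · refine ⟨r, hr, ?_⟩
        rintro q (rfl | hq) hqp
        · exact absurd hap hqp
        · exact h q hq hqp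
      · have ha : 0 < dist p a := dist_pos.2 (Ne.symm hap)
        refine ⟨min r (dist p a / 2), by positivity, ?_⟩
        rintro q (rfl | hq) hqp
        · exact (min_le_right _ _).trans_lt (half_lt_self ha)
        · exact (min_le_left _ _).trans_lt (h q hq hqp)
  obtain ⟨v, hv⟩ := exists_norm_eq Plane hr.le
  refine ⟨p + v, ?_, fun q hq hqp => ?_⟩
  · intro h
    have : v = 0 := by simpa using h
    simp [this] at hv
    linarith
  · rw [dist_self_add_right, hv]
    exact hr' q hq hqp

theorem exists_isDestination {O : Set Plane} (hO : O.Finite) (M : Set Plane) (p : Plane) :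
    ∃ d, IsDestination O M p d := by
  rcases M.eq_empty_or_nonempty with rfl | hM
  · by_cases h : ∃ q, IsClosestPartner O p q
    · obtain ⟨q, hq⟩ := h
      exact ⟨q, fun m hm => absurd hm.symm (Set.singleton_ne_empty m),
        fun h => absurd rfl h.nonempty.ne_empty, fun _ => .inl hq⟩
    · exact ⟨p, fun m hm => absurd hm.symm (Set.singleton_ne_empty m),
        fun h => absurd rfl h.nonempty.ne_empty, fun _ => .inr ⟨h, rfl⟩⟩
  · rcases hM.exists_eq_singleton_or_nontrivial with ⟨m, rfl⟩ | hM
    · by_cases h : ∀ q ∈ O, q ≠ m → dist p m ≤ dist q m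
      · exact ⟨m, fun m' hm => by obtain rfl := Set.singleton_injective hm; exact .inl ⟨h, rfl⟩,
          fun h => absurd rfl (h.ne_singleton), fun h => absurd h (Set.singleton_ne_empty m)⟩
      · exact ⟨p, fun m' hm => by obtain rfl := Set.singleton_injective hm; exact .inr ⟨h, rfl⟩,
          fun h => absurd rfl (h.ne_singleton), fun h => absurd h (Set.singleton_ne_empty m)⟩
    · by_cases h : p ∈ M
      · obtain ⟨d, hd⟩ := exists_near_of_finite hO p
        exact ⟨d, fun m hm => absurd hm hM.ne_singleton, fun _ => .inl ⟨h, hd⟩,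
          fun h => absurd h hM.nonempty.ne_empty⟩
      · exact ⟨p, fun m hm => absurd hm hM.ne_singleton, fun _ => .inr ⟨h, rfl⟩,
          fun h => absurd h hM.nonempty.ne_empty⟩

theorem isClosestPartner_image_iff {f : Plane → Plane} {k : ℝ} (hk : 0 < k)
    (hf : ∀ x y, dist (f x) (f y) = k * dist x y) {O : Set Plane} {p q : Plane} :
    IsClosestPartner (f '' O) (f p) (f q) ↔ IsClosestPartner O p q := by
  have inj : Function.Injective f := fun x y h => by
    have := hf x y
    rw [h, dist_self, zero_eq_mul] at this
    exact dist_eq_zero.1 (this.resolve_left hk.ne')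
  simp only [IsClosestPartner, Set.forall_mem_image, inj.mem_set_image, inj.ne_iff, hf,
    mul_le_mul_iff_right₀ hk]

/-- Allowed destinations do not depend on the frame in which they are expressed. -/
theorem IsDestination.of_image {f : Plane → Plane} {k : ℝ} (hk : 0 < k)
    (hf : ∀ x y, dist (f x) (f y) = k * dist x y) {O M : Set Plane} {p d : Plane}
    (h : IsDestination (f '' O) (f '' M) (f p) (f d)) : IsDestination O M p d := by
  have inj : Function.Injective f := fun x y h => by
    have := hf x y
    rw [h, dist_self, zero_eq_mul] at this
    exact dist_eq_zero.1 (this.resolve_left hk.ne')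
  refine ⟨fun m hm => ?_, fun hM => ?_, fun hM => ?_⟩
  · have := h.unique (f m) (by rw [hm, Set.image_singleton])
    simpa only [Set.forall_mem_image, inj.ne_iff, inj.eq_iff, hf, mul_le_mul_iff_right₀ hk]
      using this
  · have := h.several (hM.image inj)
    simpa only [Set.forall_mem_image, inj.ne_iff, inj.eq_iff, hf, mul_lt_mul_iff_right₀ hk,
      inj.mem_set_image] using this
  · have := h.none (by rw [hM, Set.image_empty])
    rw [isClosestPartner_image_iff hk hf, inj.eq_iff] at this
    refine this.imp_right fun ⟨h₁, h₂⟩ => ⟨?_, h₂⟩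
    rintro ⟨q, hq⟩
    exact h₁ ⟨f q, (isClosestPartner_image_iff hk hf).2 hq⟩

/-- An allowed destination for a robot at the origin, from its tagged view. -/
def gatherAlgorithm (S : Finset (Plane × Bool)) : Plane :=
  (exists_isDestination (S.finite_toSet.image Prod.fst) {x | (x, true) ∈ S} 0).choose

theorem gatherAlgorithm_spec (S : Finset (Plane × Bool)) :
    IsDestination (Prod.fst '' (S : Set (Plane × Bool))) {x | (x, true) ∈ S} 0
      (gatherAlgorithm S) :=
  (exists_isDestination (S.finite_toSet.image Prod.fst) {x | (x, true) ∈ S} 0).choose_spec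

theorem two_le_card_filter_iff {n : ℕ} (c : Fin n → Plane) (q : Plane) :
    2 ≤ (Finset.univ.filter (fun i : Fin n => c i = q)).card ↔ q ∈ multiplicityPoints c := by
  rw [← Nat.lt_iff_add_one_le, Finset.one_lt_card]
  simp only [Finset.mem_filter, Finset.mem_univ, true_and, multiplicityPoints, Set.mem_ofPred_eq]
  constructor
  · rintro ⟨i, hi, j, hj, hij⟩
    exact ⟨i, j, hij, hi, hj⟩
  · rintro ⟨i, j, hij, hi, hj⟩
    exact ⟨i, hi, j, hj, hij⟩

theorem isDestination_gatherAlgorithm {n : ℕ} (c : Fin n → Plane) (p : Plane) {k : ℝ}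
    (hk : 0 < k) (L : Plane ≃ₗᵢ[ℝ] Plane) :
    IsDestination (Set.range c) (multiplicityPoints c) p
      (L.symm (k⁻¹ • gatherAlgorithm (Finset.image
        (fun q => (k • L (q - p),
          decide (2 ≤ (Finset.univ.filter (fun i : Fin n => c i = q)).card)))
        (Finset.image c Finset.univ))) + p) := by
  set S := Finset.image
        (fun q => (k • L (q - p),
          decide (2 ≤ (Finset.univ.filter (fun i : Fin n => c i = q)).card)))
        (Finset.image c Finset.univ) with hS
  have hf : ∀ x y, dist (k • L (x - p)) (k • L (y - p)) = k * dist x y := fun x y => by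
    rw [dist_smul₀, L.dist_map, dist_sub_right, Real.norm_of_nonneg hk.le]
  refine IsDestination.of_image (f := fun q => k • L (q - p)) hk hf ?_
  convert gatherAlgorithm_spec S using 1
  · ext x
    simp [hS]
  · ext x
    simp only [hS, Finset.mem_image, Finset.mem_univ, true_and, Set.mem_image, Set.mem_ofPred_eq,
      Prod.mk.injEq, decide_eq_true_eq, two_le_card_filter_iff]
    constructor
    · rintro ⟨q, hq, rfl⟩
      obtain ⟨i, j, hij, hi, hj⟩ := hq
      exact ⟨q, ⟨i, hi⟩, rfl, i, j, hij, hi, hj⟩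
    · rintro ⟨q, -, h, hq⟩
      exact ⟨q, hq, h⟩
  · simp
  · simp [hk.ne']

theorem NonRigidMove.eq_of_self {δ : ℝ} {p p' : Plane} (h : NonRigidMove δ p p p') :
    p' = p := by
  simpa [segment_same] using h.1

theorem NonRigidMove.dist_lt {δ : ℝ} (hδ : 0 < δ) {p d p' : Plane}
    (h : NonRigidMove δ p d p') (hd : d ≠ p) : dist p' d < dist p d :=
  h.2.trans_lt (max_lt (by linarith) (dist_pos.2 hd.symm))

theorem NonRigidMove.ceil_lt {δ : ℝ} (hδ : 0 < δ) {p d p' : Plane}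
    (h : NonRigidMove δ p d p') (hd : d ≠ p) : ⌈dist p' d / δ⌉₊ < ⌈dist p d / δ⌉₊ := by
  have hp : 0 < dist p d / δ := div_pos (dist_pos.2 hd.symm) hδ
  rcases le_max_iff.1 h.2 with h' | h'
  · have h1 : dist p' d / δ + 1 ≤ dist p d / δ := by
      rw [← div_self hδ.ne', ← add_div]
      gcongr
      linarith
    have h2 := Nat.ceil_mono h1
    rw [Nat.ceil_add_one (by positivity)] at h2
    omega
  · rw [le_antisymm h' dist_nonneg, zero_div, Nat.ceil_zero]
    exact Nat.ceil_pos.2 hp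

theorem NonRigidMove.dist_left_le {δ : ℝ} {p d p' : Plane}
    (h : NonRigidMove δ p d p') : dist p p' ≤ dist p d := by
  have := dist_add_dist_of_mem_segment h.1
  linarith [dist_nonneg (x := p') (y := d)]

/-- A measure that decreases lexicographically whenever the configuration changes. -/
def gatherPotential (δ : ℝ) {n : ℕ} (c : Fin n → Plane) : ℕ ×ₗ ℕ :=
  if (multiplicityPoints c).Nontrivial then
    toLex (2, (Finset.univ.filter fun i => c i ∈ multiplicityPoints c).card)
  else if multiplicityPoints c = ∅ then
    toLex (1, sInf {v | ∃ i j, i ≠ j ∧ v = ⌈dist (c i) (c j) / δ⌉₊})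
  else toLex (0, ∑ i, ⌈Metric.infDist (c i) (multiplicityPoints c) / δ⌉₊)

theorem gatherPotential_of_singleton (δ : ℝ) {n : ℕ} {c : Fin n → Plane} {m : Plane}
    (h : multiplicityPoints c = {m}) :
    gatherPotential δ c = toLex (0, ∑ i, ⌈dist (c i) m / δ⌉₊) := by
  simp [gatherPotential, h]

section Step

variable {n : ℕ} {δ : ℝ} {c c' : Fin n → Plane} {s : Fin n} {d : Plane}

/-- A new multiplicity point can only be the position of the moving robot. -/
theorem multiplicityPoints_step (hc : ∀ j, j ≠ s → c' j = c j) {x : Plane}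
    (hx : x ∈ multiplicityPoints c') :
    x ∈ multiplicityPoints c ∨ (x = c' s ∧ ∃ j, j ≠ s ∧ c j = c' s) := by
  obtain ⟨i, j, hij, hi, hj⟩ := hx
  by_cases his : i = s
  · subst his
    have hji := hij.symm
    exact .inr ⟨hi.symm, j, hji, by rw [← hc j hji, hj, hi]⟩
  · by_cases hjs : j = s
    · subst hjs
      exact .inr ⟨hj.symm, i, hij, by rw [← hc i hij, hj, hi]⟩
    · exact .inl ⟨i, j, hij, by rw [← hc i his, hi], by rw [← hc j hjs, hj]⟩

theorem gatherPotential_lt_of_unique (hδ : 0 < δ) (hc : ∀ j, j ≠ s → c' j = c j)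
    (hmove : NonRigidMove δ (c s) d (c' s)) (hds : d ≠ c s)
    (hM : multiplicityPoints c = {d})
    (hnear : ∀ q ∈ Set.range c, q ≠ d → dist (c s) d ≤ dist q d) :
    gatherPotential δ c' < gatherPotential δ c := by
  have hlt := hmove.dist_lt hδ hds
  have hM' : multiplicityPoints c' = {d} := by
    refine Set.Subset.antisymm (fun x hx => ?_) ?_
    · rcases multiplicityPoints_step hc hx with h | ⟨rfl, j, -, hj⟩
      · rwa [hM] at h
      · by_contra hne
        exact absurd (hnear _ ⟨j, hj⟩ hne) hlt.not_ge
    · rw [Set.singleton_subset_iff]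
      obtain ⟨i, j, hij, hi, hj⟩ : d ∈ multiplicityPoints c := by simp [hM]
      refine ⟨i, j, hij, ?_, ?_⟩
      · rw [hc i (by rintro rfl; exact hds hi.symm), hi]
      · rw [hc j (by rintro rfl; exact hds hj.symm), hj]
  rw [gatherPotential_of_singleton δ hM, gatherPotential_of_singleton δ hM',
    Prod.Lex.toLex_lt_toLex]
  refine .inr ⟨rfl, Finset.sum_lt_sum (fun i _ => ?_) ⟨s, Finset.mem_univ s, hmove.ceil_lt hδ hds⟩⟩
  by_cases his : i = s
  · subst his
    exact (hmove.ceil_lt hδ hds).le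
  · rw [hc i his]

theorem gatherPotential_lt_of_several (hδ : 0 < δ) (hc : ∀ j, j ≠ s → c' j = c j)
    (hmove : NonRigidMove δ (c s) d (c' s)) (hds : d ≠ c s)
    (hM : (multiplicityPoints c).Nontrivial) (hs : c s ∈ multiplicityPoints c)
    (hfree : ∀ q ∈ Set.range c, q ≠ c s → dist (c s) d < dist (c s) q) :
    gatherPotential δ c' < gatherPotential δ c := by
  have hne : c' s ≠ c s := fun h => by
    have := hmove.dist_lt hδ hds
    rw [h] at this
    exact lt_irrefl _ this
  have hnew : ∀ j, c j ≠ c' s := fun j hj =>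
    absurd (hfree _ ⟨j, hj⟩ hne) hmove.dist_left_le.not_gt
  have hsub : ∀ x ∈ multiplicityPoints c', x ∈ multiplicityPoints c := fun x hx =>
    (multiplicityPoints_step hc hx).resolve_right fun ⟨_, j, _, hj⟩ => hnew j hj
  have hs' : c' s ∉ multiplicityPoints c' := fun h => by
    obtain ⟨i, -, -, hi, -⟩ := hsub _ h
    exact hnew i hi
  rw [gatherPotential, gatherPotential, if_pos hM]
  split_ifs
  · rw [Prod.Lex.toLex_lt_toLex]
    refine .inr ⟨rfl, ?_⟩
    dsimp only
    refine Finset.card_lt_card ?_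
    rw [Finset.ssubset_iff_of_subset]
    · exact ⟨s, by simpa using hs, by simpa using hs'⟩
    · intro i hi
      simp only [Finset.mem_filter, Finset.mem_univ, true_and] at hi ⊢
      have his : i ≠ s := by rintro rfl; exact hs' hi
      rw [← hc i his]
      exact hsub _ hi
  · simp [Prod.Lex.toLex_lt_toLex]
  · simp [Prod.Lex.toLex_lt_toLex]

theorem gatherPotential_lt_of_none (hδ : 0 < δ) (hc : ∀ j, j ≠ s → c' j = c j)
    (hmove : NonRigidMove δ (c s) d (c' s)) (hM : multiplicityPoints c = ∅)
    (hd : IsClosestPartner (Set.range c) (c s) d) :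
    gatherPotential δ c' < gatherPotential δ c := by
  obtain ⟨⟨j, rfl⟩, hds, hmin⟩ := hd
  have hlt := hmove.dist_lt hδ hds
  have hjs : j ≠ s := by rintro rfl; exact hds rfl
  have hsub : multiplicityPoints c' ⊆ {c j} := fun x hx => by
    rcases multiplicityPoints_step hc hx with h | ⟨rfl, i, -, hi⟩
    · simp [hM] at h
    · by_contra hne
      exact absurd (hmin _ ⟨i, hi⟩ _ ⟨j, rfl⟩ hne) hlt.not_ge
  have hinj : ∀ a b, a ≠ b → c a ≠ c b := fun a b hab h => by
    have : c b ∈ multiplicityPoints c := ⟨a, b, hab, h, rfl⟩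
    simp [hM] at this
  have hnt : ¬ (multiplicityPoints c').Nontrivial := fun h =>
    (h.mono hsub).ne_singleton rfl
  have hnt' : ¬ (multiplicityPoints c).Nontrivial := fun h => h.nonempty.ne_empty hM
  rw [gatherPotential, gatherPotential, if_neg hnt, if_neg hnt', if_pos hM]
  split_ifs
  · rw [Prod.Lex.toLex_lt_toLex]
    refine .inr ⟨rfl, ?_⟩
    have hne : {v | ∃ i j, i ≠ j ∧ v = ⌈dist (c i) (c j) / δ⌉₊}.Nonempty := ⟨_, j, s, hjs, rfl⟩
    obtain ⟨a, b, hab, hv⟩ := Nat.sInf_mem hne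
    change _ < sInf {v | ∃ i j, i ≠ j ∧ v = ⌈dist (c i) (c j) / δ⌉₊}
    rw [hv]
    calc sInf {v | ∃ i j, i ≠ j ∧ v = ⌈dist (c' i) (c' j) / δ⌉₊}
        ≤ ⌈dist (c' s) (c j) / δ⌉₊ := Nat.sInf_le ⟨s, j, hjs.symm, by rw [hc j hjs]⟩
      _ < ⌈dist (c s) (c j) / δ⌉₊ := hmove.ceil_lt hδ hds
      _ ≤ _ := Nat.ceil_mono (by
        gcongr
        exact hmin _ ⟨a, rfl⟩ _ ⟨b, rfl⟩ (hinj a b hab))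
  · simp [Prod.Lex.toLex_lt_toLex]

theorem eq_or_gatherPotential_lt (hδ : 0 < δ) (hc : ∀ j, j ≠ s → c' j = c j)
    (hmove : NonRigidMove δ (c s) d (c' s))
    (hd : IsDestination (Set.range c) (multiplicityPoints c) (c s) d) :
    c' = c ∨ gatherPotential δ c' < gatherPotential δ c := by
  by_cases hds : d = c s
  · refine .inl (funext fun j => ?_)
    by_cases hj : j = s
    · subst hj
      subst hds
      exact hmove.eq_of_self
    · exact hc j hj
  right
  rcases (multiplicityPoints c).eq_empty_or_nonempty with hM | hM
  · exact gatherPotential_lt_of_none hδ hc hmove hM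
      ((hd.none hM).resolve_right fun h => hds h.2)
  rcases hM.exists_eq_singleton_or_nontrivial with ⟨m, hM⟩ | hM
  · obtain ⟨hnear, rfl⟩ := (hd.unique m hM).resolve_right fun h => hds h.2
    exact gatherPotential_lt_of_unique hδ hc hmove hds hM hnear
  · obtain ⟨hs, -, hfree⟩ := (hd.several hM).resolve_right fun h => hds h.2
    exact gatherPotential_lt_of_several hδ hc hmove hds hM hs hfree

theorem IsDestination.eq_of_gathered (hg : ∀ i j, c i = c j)
    (hd : IsDestination (Set.range c) (multiplicityPoints c) (c s) d) : d = c s := by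
  have hsub : multiplicityPoints c ⊆ {c s} := by
    rintro x ⟨i, -, -, rfl, -⟩
    exact hg i s
  rcases Set.subset_singleton_iff_eq.1 hsub with hM | hM
  · rcases hd.none hM with ⟨⟨j, rfl⟩, hne, -⟩ | h
    · exact absurd (hg j s) hne
    · exact h.2
  · rcases hd.unique _ hM with h | h <;> exact h.2

theorem exists_forall_isDestination_ne (hg : ¬ ∀ i j, c i = c j) :
    ∃ s, ∀ d, IsDestination (Set.range c) (multiplicityPoints c) (c s) d → d ≠ c s := by
  push Not at hg
  obtain ⟨i₀, j₀, hij⟩ := hg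
  rcases (multiplicityPoints c).eq_empty_or_nonempty with hM | hM
  · obtain ⟨⟨i, j⟩, hmem, hmin⟩ := Finset.exists_min_image
      (Finset.univ.filter fun z : Fin n × Fin n => c z.1 ≠ c z.2)
      (fun z => dist (c z.1) (c z.2)) ⟨(i₀, j₀), by simpa using hij⟩
    simp only [Finset.mem_filter, Finset.mem_univ, true_and, Prod.forall] at hmem hmin
    refine ⟨i, fun d hd => ?_⟩
    rcases hd.none hM with h | h
    · exact h.2.1
    · refine absurd ⟨c j, ⟨j, rfl⟩, hmem.symm, ?_⟩ h.1
      rintro _ ⟨a, rfl⟩ _ ⟨b, rfl⟩ hab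
      exact hmin a b hab
  rcases hM.exists_eq_singleton_or_nontrivial with ⟨m, hM⟩ | hM
  · have hne : (Finset.univ.filter fun i => c i ≠ m).Nonempty := by
      by_cases h : c i₀ = m
      · exact ⟨j₀, by simpa [← h] using hij.symm⟩
      · exact ⟨i₀, by simpa using h⟩
    obtain ⟨s, hs, hmin⟩ := Finset.exists_min_image _ (fun i => dist (c i) m) hne
    simp only [Finset.mem_filter, Finset.mem_univ, true_and] at hs hmin
    refine ⟨s, fun d hd => ?_⟩
    rcases hd.unique m hM with h | h
    · rw [h.2]
      exact hs.symm
    · refine absurd ?_ h.1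
      rintro _ ⟨a, rfl⟩ ha
      exact hmin a ha
  · obtain ⟨x, i, j, hne, rfl, hj⟩ := hM.nonempty
    refine ⟨i, fun d hd => ?_⟩
    rcases hd.several hM with h | h
    · exact h.2.1
    · exact absurd ⟨i, j, hne, rfl, hj⟩ h.1

end Step

/-- `Gathering` is solvable with weak multiplicity detection under any sequential
scheduler: there is an algorithm `A` (input: the occupied points in the active robot's
local frame, each tagged with a Boolean recording whether at least two robots occupy it)
such that every `δ`-non-rigid sequential execution under a fair schedule, with arbitrary
local frames `x ↦ k t • L t (x - c t (σ t))` (`k t > 0`, `L t` a linear isometry),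
eventually brings and keeps all robots at a single common point. -/
theorem stmt_6 :
    ∃ A : Finset (Plane × Bool) → Plane,
      ∀ (n : ℕ), 1 ≤ n → ∀ (δ : ℝ), 0 < δ →
      ∀ (c : ℕ → Fin n → Plane) (σ : ℕ → Fin n) (k : ℕ → ℝ)
        (L : ℕ → Plane ≃ₗᵢ[ℝ] Plane),
        (∀ i : Fin n, ∀ t : ℕ, ∃ t' > t, σ t' = i) →
        (∀ t, 0 < k t) →
        (∀ t, NonRigidMove δ (c t (σ t))
          ((L t).symm ((k t)⁻¹ • A (Finset.image
            (fun q => (k t • L t (q - c t (σ t)),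
              decide (2 ≤ (Finset.univ.filter (fun i : Fin n => c t i = q)).card)))
            (Finset.image (c t) Finset.univ))) + c t (σ t))
          (c (t + 1) (σ t))) →
        (∀ t, ∀ j : Fin n, j ≠ σ t → c (t + 1) j = c t j) →
        ∃ T, ∀ t ≥ T, ∀ i j : Fin n, c t i = c t j := by
  refine ⟨gatherAlgorithm, ?_⟩
  intro n _ δ hδ c σ k L hfair hk hmove hstay
  have hdest := fun t => isDestination_gatherAlgorithm (c t) (c t (σ t)) (hk t) (L t)
  have hstep : ∀ t, c (t + 1) = c t ∨ gatherPotential δ (c (t + 1)) < gatherPotential δ (c t) :=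
    fun t => eq_or_gatherPotential_lt hδ (hstay t) (hmove t) (hdest t)
  have hlater : ∀ t u, t ≤ u → c u = c t ∨ gatherPotential δ (c u) < gatherPotential δ (c t) := by
    intro t u htu
    induction u, htu using Nat.le_induction with
    | base => exact .inl rfl
    | succ u _ ih =>
      rcases hstep u with h | h <;> rcases ih with h' | h'
      · exact .inl (h.trans h')
      · exact .inr (by rwa [h])
      · exact .inr (by rwa [h'] at h)
      · exact .inr (h.trans h')
  have hgather : ∀ x : ℕ ×ₗ ℕ, ∀ t, gatherPotential δ (c t) = x →
      ∃ T, ∀ i j, c T i = c T j := by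
    intro x
    induction x using WellFoundedLT.induction with
    | ind x ih =>
      rintro t rfl
      by_cases hg : ∀ i j, c t i = c t j
      · exact ⟨t, hg⟩
      obtain ⟨s, hs⟩ := exists_forall_isDestination_ne hg
      obtain ⟨u, htu, rfl⟩ := hfair s t
      rcases hlater t u htu.le with h | h
      · have hmv := hmove u
        have hne := hs _ (h ▸ hdest u)
        rw [← h] at hne
        have hlt := hmv.dist_lt hδ hne
        rcases hstep u with h' | h'
        · rw [h'] at hlt
          exact absurd hlt (lt_irrefl _)
        · exact ih _ (h ▸ h') (u + 1) rfl
      · exact ih _ h u rfl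
  obtain ⟨T, hT⟩ := hgather _ 0 rfl
  refine ⟨T, fun t ht => ?_⟩
  induction t, ht using Nat.le_induction with
  | base => exact hT
  | succ t _ ih =>
    have hmv := hmove t
    rw [(hdest t).eq_of_gathered ih] at hmv
    have heq := hmv.eq_of_self
    have hall : ∀ j, c (t + 1) j = c t j := fun j => by
      by_cases hj : j = σ t
      · rw [hj, heq]
      · exact hstay t j hj
    intro i j
    rw [hall i, hall j, ih i j]
end
end

section
/- Gathering is unsolvable under the semi-synchronous scheduler SSYNC even with strong multiplicity detection: for every algorithm A : Multiset ℝ² → ℝ² (input: the multiset of all robot positions expressed in the active robot's local frame; output: a destination in that frame) and every m ≥ 1, there exist an initial configuration of n = 2m robots consisting of two groups of m robots each located at two distinct points, a fair SSYNC schedule R : ℕ → Set (Fin n) (each R t nonempty, and every robot belongs to R t for infinitely many t), and local coordinate frames φ_{t,i} at the position of each robot i ∈ R t, such that in the resulting rigid execution — where at round t every robot i ∈ R t simultaneously moves to φ_{t,i}⁻¹ (A (image under φ_{t,i} of the position multiset of c_t)) and all other robots stay put — at every time t the robots do not all occupy a single point. -/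
noncomputable section

open scoped Classical

theorem map_univ_two_groups {α : Type*} (m : ℕ) (f : Bool → α) :
    Multiset.map (fun i : Fin (2 * m) => f (decide ((i : ℕ) < m))) Finset.univ.val =
      Multiset.replicate m (f true) + Multiset.replicate m (f false) := by
  generalize hn : 2 * m = n
  obtain rfl : n = m + m := by omega
  rw [Fin.univ_val_map, List.ofFn_add, ← Multiset.coe_add]
  simp [← Multiset.coe_replicate]

theorem replicate_add_replicate_not {α : Type*} (m : ℕ) (f : Bool → α) (g : Bool) :
    Multiset.replicate m (f true) + Multiset.replicate m (f false) =
      Multiset.replicate m (f g) + Multiset.replicate m (f !g) := by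
  cases g
  · exact add_comm _ _
  · rfl

/-- Every nonzero vector is sent to any prescribed unit vector by a similarity. -/
theorem exists_smul_linearIsometryEquiv_eq_s7 {E : Type*} [NormedAddCommGroup E]
    [InnerProductSpace ℝ E] [CompleteSpace E] {e : E} (he : ‖e‖ = 1) (v : E) :
    ∃ (k : ℝ) (L : E ≃ₗᵢ[ℝ] E), 0 < k ∧ (v ≠ 0 → k • L v = e) := by
  by_cases hv : v = 0
  · exact ⟨1, LinearIsometryEquiv.refl ℝ E, one_pos, fun h => absurd hv h⟩
  have hpos : 0 < ‖v‖ := norm_pos_iff.mpr hv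
  refine ⟨‖v‖⁻¹, Submodule.reflection (ℝ ∙ (‖v‖⁻¹ • v - e))ᗮ, inv_pos.mpr hpos, fun _ => ?_⟩
  rw [← map_smul]
  apply Submodule.reflection_sub
  rw [norm_smul, norm_inv, norm_norm, inv_mul_cancel₀ hpos.ne', he]

/-- Positions of the two groups over time: at round `t` the groups `g` with `act t g` move by
`M` applied to the displacement towards the other group. -/
def groupPositions (p : Bool → Plane) (act : ℕ → Bool → Prop) (M : Plane → Plane) :
    ℕ → Bool → Plane
  | 0 => p
  | t + 1 => fun g =>
      if act t g then
        M (groupPositions p act M t (!g) - groupPositions p act M t g) +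
          groupPositions p act M t g
      else groupPositions p act M t g

theorem groupPositions_ne {p : Bool → Plane} {act : ℕ → Bool → Prop} {M : Plane → Plane}
    (hp : ∀ g, p (!g) ≠ p g)
    (h : (∀ v ≠ 0, M v = v) ∧ (∀ t g, act t g) ∨
      (∀ v ≠ 0, M v ≠ v) ∧ ∀ t g, ¬ (act t g ∧ act t !g)) (t : ℕ) (g : Bool) :
    groupPositions p act M t (!g) ≠ groupPositions p act M t g := by
  induction t generalizing g with
  | zero => exact hp g
  | succ t ih =>
    rcases h with ⟨hM, hact⟩ | ⟨hM, hact⟩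
    · simp only [groupPositions, hact, if_true, Bool.not_not]
      rw [hM _ (sub_ne_zero.mpr (ih g)), hM _ (sub_ne_zero.mpr (ih g).symm)]
      simpa using (ih g).symm
    · have hne : ∀ g', M (groupPositions p act M t (!g') - groupPositions p act M t g') +
          groupPositions p act M t g' ≠ groupPositions p act M t (!g') := fun g' h' =>
        hM _ (sub_ne_zero.mpr (ih g')) (eq_sub_of_add_eq h')
      by_cases h1 : act t g
      · have h2 : ¬ act t !g := fun h2 => hact t g ⟨h1, h2⟩
        simp only [groupPositions, h1, h2, if_true, if_false]
        exact (hne g).symm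
      · by_cases h2 : act t !g
        · simp only [groupPositions, h1, h2, if_true, if_false]
          simpa using hne (!g)
        · simp only [groupPositions, h1, h2, if_false]
          exact ih g

/-- `Gathering` is unsolvable under `SSYNC` even with strong multiplicity detection: for
any algorithm `A` (acting on the multiset of robot positions seen in the active robot's
local frame) and any `m ≥ 1` there are an initial configuration of `2 * m` robots split
into two groups of `m` robots at two distinct points, a fair `SSYNC` schedule `R`, and
local frames `x ↦ k t i • L t i (x - c t i)` (`k t i > 0`, `L t i` a linear isometry)
such that the resulting rigid execution never has all robots at a single point. -/
theorem stmt_7 (A : Multiset Plane → Plane) (m : ℕ) (hm : 1 ≤ m) :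
    ∃ (a b : Plane) (c : ℕ → Fin (2 * m) → Plane) (R : ℕ → Set (Fin (2 * m)))
      (k : ℕ → Fin (2 * m) → ℝ) (L : ℕ → Fin (2 * m) → Plane ≃ₗᵢ[ℝ] Plane),
      a ≠ b ∧
      (∀ i : Fin (2 * m), c 0 i = if (i : ℕ) < m then a else b) ∧
      (∀ t, (R t).Nonempty) ∧
      (∀ i : Fin (2 * m), ∀ t, ∃ t' > t, i ∈ R t') ∧
      (∀ t, ∀ i : Fin (2 * m), 0 < k t i) ∧
      (∀ t, ∀ i ∈ R t, c (t + 1) i =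
        (L t i).symm ((k t i)⁻¹ • A (Multiset.map
          (fun x => k t i • L t i (x - c t i))
          (Multiset.map (c t) Finset.univ.val))) + c t i) ∧
      (∀ t, ∀ i : Fin (2 * m), i ∉ R t → c (t + 1) i = c t i) ∧
      (∀ t, ¬ ∃ p : Plane, ∀ i : Fin (2 * m), c t i = p) := by
  obtain ⟨e, he⟩ : ∃ e : Plane, ‖e‖ = 1 := ⟨EuclideanSpace.single 0 1, by simp⟩
  have he0 : e ≠ 0 := norm_ne_zero_iff.mp (by rw [he]; exact one_ne_zero)
  choose κ Λ hκ hΛ using exists_smul_linearIsometryEquiv_eq_s7 he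
  let d := A (Multiset.replicate m 0 + Multiset.replicate m e)
  let M : Plane → Plane := fun v => (Λ v).symm ((κ v)⁻¹ • d)
  have hM : ∀ v ≠ 0, (M v = v ↔ d = e) := fun v hv => by
    rw [← hΛ v hv, LinearIsometryEquiv.symm_apply_eq, inv_smul_eq_iff₀ (hκ v).ne']
  let act : ℕ → Bool → Prop := fun t g => d = e ∨ g = decide (Even t)
  let p : Bool → Plane := fun g => if g then 0 else e
  let s := groupPositions p act M
  have hs : ∀ t g, s t (!g) ≠ s t g := by
    refine groupPositions_ne (fun g => ?_) ?_
    · cases g <;> simp [p, he0, he0.symm]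
    · by_cases hde : d = e
      · exact Or.inl ⟨fun v hv => (hM v hv).mpr hde, fun _ _ => Or.inl hde⟩
      · refine Or.inr ⟨fun v hv h => hde ((hM v hv).mp h), fun t g h => ?_⟩
        have h1 := h.1.resolve_left hde
        have h2 := h.2.resolve_left hde
        exact Bool.not_ne_self g (h2.trans h1.symm)
  let grp : Fin (2 * m) → Bool := fun i => decide ((i : ℕ) < m)
  have hgrp : ∀ g, ∃ i, grp i = g := fun g => by
    cases g
    · exact ⟨⟨m, by omega⟩, by simp [grp]⟩
    · exact ⟨⟨0, by omega⟩, by simp only [grp, decide_eq_true_eq]; omega⟩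
  let v : ℕ → Fin (2 * m) → Plane := fun t i => s t (!grp i) - s t (grp i)
  have hv : ∀ t i, v t i ≠ 0 := fun t i => sub_ne_zero.mpr (hs t (grp i))
  refine ⟨0, e, fun t i => s t (grp i), fun t => {i | act t (grp i)},
    fun t i => κ (v t i), fun t i => Λ (v t i), he0.symm, fun i => ?_, fun t => ?_,
    fun i t => ?_, fun t i => hκ _, fun t i hi => ?_, fun t i hi => if_neg hi, ?_⟩
  · simp [s, groupPositions, p, grp]
  · obtain ⟨i, hi⟩ := hgrp (decide (Even t))
    exact ⟨i, Or.inr hi⟩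
  · by_cases h : grp i = decide (Even (t + 1))
    · exact ⟨t + 1, by omega, Or.inr h⟩
    · refine ⟨t + 2, by omega, Or.inr ?_⟩
      have h2 : decide (Even (t + 2)) = !decide (Even (t + 1)) := by
        simp only [Nat.even_add_one (n := t + 1), decide_not]
      rw [h2]
      exact Bool.eq_not.mpr h
  · have hsnap : Multiset.map (fun x => κ (v t i) • Λ (v t i) (x - s t (grp i)))
        (Multiset.map (fun j => s t (grp j)) Finset.univ.val) =
        Multiset.replicate m 0 + Multiset.replicate m e := by
      rw [map_univ_two_groups m (s t), replicate_add_replicate_not m (s t) (grp i),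
        Multiset.map_add, Multiset.map_replicate, Multiset.map_replicate, sub_self, map_zero,
        smul_zero, hΛ _ (hv t i)]
    simp only [hsnap]
    exact if_pos hi
  · rintro t ⟨q, hq⟩
    obtain ⟨i, hi⟩ := hgrp true
    obtain ⟨j, hj⟩ := hgrp false
    apply hs t true
    have h1 := hq i
    have h2 := hq j
    simp only [hi, hj] at h1 h2
    exact h2.trans h1.symm
end
end

section
/- Extending a maximum-distance pair by one unit creates a unique maximum-distance pair: let Q ⊆ ℝ² be a finite set and q, q' ∈ Q distinct points realizing the maximum pairwise distance d of Q (so dist q q' = d > 0 and dist a b ≤ d for all a, b ∈ Q). Let q'' = q + (1/d) • (q − q'), the point on the line through q' and q at distance 1 from q on the side opposite to q'. Then (i) dist q' q'' = d + 1; (ii) dist a b < d + 1 for all a, b ∈ Q; and (iii) dist p q'' < d + 1 for every p ∈ Q with p ≠ q'. Consequently, in the set Q ∪ {q''}, the pair {q', q''} is the unique pair of points realizing the maximum pairwise distance. -/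
noncomputable section

theorem dist_extend {E : Type*} [NormedAddCommGroup E] [NormedSpace ℝ E] {q q' : E} {d : ℝ}
    (hd : dist q q' = d) (hdpos : 0 < d) : dist q (q + (1 / d) • (q - q')) = 1 := by
  rw [dist_self_add_right, norm_smul, ← dist_eq_norm, hd, Real.norm_of_nonneg (by positivity)]
  field_simp

theorem dist_extend_far {E : Type*} [NormedAddCommGroup E] [NormedSpace ℝ E] {q q' : E} {d : ℝ}
    (hd : dist q q' = d) (hdpos : 0 < d) : dist q' (q + (1 / d) • (q - q')) = d + 1 := by
  have h : q + (1 / d) • (q - q') - q' = (1 + 1 / d) • (q - q') := by module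
  rw [dist_comm, dist_eq_norm, h, norm_smul, ← dist_eq_norm, hd,
    Real.norm_of_nonneg (by positivity)]
  field_simp

theorem dist_extend_lt {E : Type*} [NormedAddCommGroup E] [NormedSpace ℝ E]
    [StrictConvexSpace ℝ E] {p q q' : E} {d : ℝ} (hd : dist q q' = d) (hdpos : 0 < d)
    (hp : dist p q ≤ d) (hpq : p ≠ q') : dist p (q + (1 / d) • (q - q')) < d + 1 := by
  have h1 := dist_extend hd hdpos
  have htri := dist_triangle p q (q + (1 / d) • (q - q'))
  refine lt_of_le_of_ne (by linarith) fun heq => hpq ?_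
  have hpd : dist p q = d := by linarith
  have hray : SameRay ℝ (q - p) ((1 / d) • (q - q')) := by
    rw [sameRay_iff_norm_add, ← dist_eq_norm, dist_comm q p, hpd, ← dist_self_add_right ((1 / d) • (q - q')) q,
      h1, ← heq, dist_comm p, dist_eq_norm]
    congr 1
    abel
  replace hray := hray.nonneg_smul_right hdpos.le
  rw [smul_smul, mul_one_div_cancel hdpos.ne', one_smul, sameRay_iff_of_norm_eq
    (by rw [← dist_eq_norm, ← dist_eq_norm, hd, dist_comm, hpd])] at hray
  exact sub_right_injective hray

/-- Extending a maximum-distance pair by one unit creates a unique maximum-distance pair: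
if `q, q' ∈ Q` realize the maximum pairwise distance `d > 0` of the finite set `Q` and
`q'' = q + (1 / d) • (q - q')`, then `dist q' q'' = d + 1`, every pair of points of `Q`
is at distance `< d + 1`, every `p ∈ Q` with `p ≠ q'` satisfies `dist p q'' < d + 1`,
and consequently `{q', q''}` is the unique maximum-distance pair of `Q ∪ {q''}`. -/
theorem stmt_12 (Q : Finset Plane) (q q' : Plane) (hq : q ∈ Q) (hq' : q' ∈ Q)
    (hne : q ≠ q') (d : ℝ) (hd : dist q q' = d) (hdpos : 0 < d)
    (hmax : ∀ a ∈ Q, ∀ b ∈ Q, dist a b ≤ d) :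
    dist q' (q + (1 / d) • (q - q')) = d + 1 ∧
    (∀ a ∈ Q, ∀ b ∈ Q, dist a b < d + 1) ∧
    (∀ p ∈ Q, p ≠ q' → dist p (q + (1 / d) • (q - q')) < d + 1) ∧
    (∀ a ∈ insert (q + (1 / d) • (q - q')) (↑Q : Set Plane),
      ∀ b ∈ insert (q + (1 / d) • (q - q')) (↑Q : Set Plane),
        dist a b ≤ d + 1) ∧
    (∀ a ∈ insert (q + (1 / d) • (q - q')) (↑Q : Set Plane),
      ∀ b ∈ insert (q + (1 / d) • (q - q')) (↑Q : Set Plane),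
        ({a, b} : Set Plane) ≠ {q', q + (1 / d) • (q - q')} →
          dist a b < d + 1) := by
  have h1 := dist_extend_far hd hdpos
  have h2 : ∀ a ∈ Q, ∀ b ∈ Q, dist a b < d + 1 := fun a ha b hb => by
    linarith [hmax a ha b hb]
  have h3 : ∀ p ∈ Q, p ≠ q' → dist p (q + (1 / d) • (q - q')) < d + 1 := fun p hp hpq =>
    dist_extend_lt hd hdpos (hmax p hp q hq) hpq
  generalize q + (1 / d) • (q - q') = r at *
  have h4 : ∀ a ∈ insert r (↑Q : Set Plane), ∀ b ∈ insert r (↑Q : Set Plane),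
      ({a, b} : Set Plane) ≠ {q', r} → dist a b < d + 1 := by
    rintro a (rfl | ha) b (rfl | hb) hab
    · rw [dist_self]
      positivity
    · rw [dist_comm]
      exact h3 b hb fun h => hab (by rw [h, Set.pair_comm])
    · exact h3 a ha fun h => hab (by rw [h])
    · exact h2 a ha b hb
  refine ⟨h1, h2, h3, fun a ha b hb => ?_, h4⟩
  by_cases hab : ({a, b} : Set Plane) = {q', r}
  · rcases Set.pair_eq_pair_iff.mp hab with ⟨rfl, rfl⟩ | ⟨rfl, rfl⟩
    · exact h1.le
    · exact (dist_comm a b).trans_le h1.le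
  · exact (h4 a ha b hb hab).le
end
end

section
/- Moving a non-extremal robot along a segment toward one endpoint of the unique maximum-distance pair preserves that pair: let Q ⊆ ℝ² be finite and q1, q2 ∈ Q distinct such that dist q1 q2 is the maximum pairwise distance of Q and every pair {a, b} ⊆ Q with {a, b} ≠ {q1, q2} satisfies dist a b < dist q1 q2 (i.e., {q1, q2} is the unique maximum-distance pair of Q). Let q ∈ Q with q ∉ {q1, q2}, and let q' be any point of the closed segment [q, q1]. Then for all a, b ∈ Q ∪ {q'} with {a, b} ≠ {q1, q2}, dist a b < dist q1 q2; i.e., {q1, q2} remains the unique maximum-distance pair of Q ∪ {q'}. -/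
noncomputable section

/-- A point of `[q, p]` other than `p` is at distance less than `r` from `x`, provided `q` is in the
open ball and `p` in the closed ball of radius `r` around `x`. -/
theorem dist_lt_of_mem_segment {E : Type*} [SeminormedAddCommGroup E] [NormedSpace ℝ E]
    {p q y x : E} {r : ℝ} (hy : y ∈ segment ℝ q p) (hyp : y ≠ p)
    (hq : dist q x < r) (hp : dist p x ≤ r) : dist y x < r := by
  obtain ⟨s, t, hs, ht, hst, rfl⟩ := hy
  have hs' : 0 < s := by
    refine hs.lt_of_ne fun h => hyp ?_
    subst h
    obtain rfl : t = 1 := by linarith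
    simp
  have hconv := (convexOn_univ_dist x).2 (Set.mem_univ q) (Set.mem_univ p) hs ht hst
  simp only [smul_eq_mul] at hconv
  calc dist (s • q + t • p) x ≤ s * dist q x + t * dist p x := hconv
    _ < s * r + t * r := add_lt_add_of_lt_of_le (by gcongr) (by gcongr)
    _ = r := by rw [← add_mul, hst, one_mul]

/-- Moving a non-extremal robot along a segment toward one endpoint of the unique
maximum-distance pair preserves that pair: if `{q1, q2}` is the unique maximum-distance
pair of the finite set `Q`, `q ∈ Q` with `q ∉ {q1, q2}`, and `q'` lies on the closed
segment `[q, q1]`, then `{q1, q2}` is still the unique maximum-distance pair of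
`Q ∪ {q'}`. -/
theorem stmt_13 (Q : Finset Plane) (q1 q2 : Plane) (h1 : q1 ∈ Q) (h2 : q2 ∈ Q)
    (hne : q1 ≠ q2)
    (hmax : ∀ a ∈ Q, ∀ b ∈ Q, dist a b ≤ dist q1 q2)
    (huniq : ∀ a ∈ Q, ∀ b ∈ Q, ({a, b} : Set Plane) ≠ {q1, q2} → dist a b < dist q1 q2)
    (q : Plane) (hq : q ∈ Q) (hq1 : q ≠ q1) (hq2 : q ≠ q2)
    (q' : Plane) (hq' : q' ∈ segment ℝ q q1) :
    ∀ a ∈ insert q' (↑Q : Set Plane), ∀ b ∈ insert q' (↑Q : Set Plane),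
      ({a, b} : Set Plane) ≠ {q1, q2} → dist a b < dist q1 q2 := by
  by_cases hmem : q' ∈ Q
  · rwa [Set.insert_eq_of_mem (Finset.mem_coe.2 hmem)]
  have hfar : ∀ x ∈ Q, dist q' x < dist q1 q2 := fun x hx =>
    dist_lt_of_mem_segment hq' (fun h => hmem (h ▸ h1))
      (huniq q hq x hx fun h => by
        have : q ∈ ({q1, q2} : Set Plane) := h ▸ Set.mem_insert q {x}
        exact this.elim hq1 hq2)
      (hmax q1 h1 x hx)
  rintro a (rfl | ha) b (rfl | hb) hab
  · rw [dist_self]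
    exact dist_pos.2 hne
  · exact hfar b hb
  · rw [dist_comm]
    exact hfar a ha
  · exact huniq a ha b hb hab
end
end
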